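/- Let K be a field, n ≥ 1, d ≥ 0, and let M = M₀ + M₁ be a uniform determinantal representation of p_{n,d} of size N. Let V ⊆ K[x_1,…,x_n] be the K-linear span of the (N−1)×(N−1) subdeterminants of M₀ (the determinants of all submatrices of M₀ obtained by deleting one row and one column). Then F_1 · V ⊇ F_d, where F_1·V denotes the K-linear span of all products ℓ·v with ℓ ∈ F_1 and v ∈ V. -/

import Mathlib

open MvPolynomial

/-- Exponent vectors in `n` variables of total degree at most `d`. -/
def ExpLE (n d : ℕ) : Type := {α : Fin n →₀ ℕ // (α.sum fun _ e => e) ≤ d}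

noncomputable instance (n d : ℕ) : Fintype (ExpLE n d) := by
  have key : ∀ α : ExpLE n d, ∀ i, α.1 i < d + 1 := by
    intro α i
    refine Nat.lt_succ_of_le (le_trans ?_ α.2)
    by_cases h : α.1 i = 0
    · simp [h]
    · rw [Finsupp.sum]
      exact Finset.single_le_sum (f := fun j => α.1 j) (fun _ _ => Nat.zero_le _)
        (Finsupp.mem_support_iff.mpr h)
  exact Fintype.ofInjective (fun α : ExpLE n d => fun i => (⟨α.1 i, key α i⟩ : Fin (d+1)))
    (fun α β h => Subtype.ext (Finsupp.ext fun i => congrArg Fin.val (congrFun h i)))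

instance (n d : ℕ) : DecidableEq (ExpLE n d) := by
  unfold ExpLE; infer_instance

/-- The ring `R = K[x₁,…,xₙ,(c_α)_{|α|≤d}]`. -/
abbrev URing (K : Type*) [Field K] (n d : ℕ) := MvPolynomial (Fin n ⊕ ExpLE n d) K

/-- The generic polynomial `p_{n,d} = Σ_{|α|≤d} c_α x^α`. -/
noncomputable def genPoly (K : Type*) [Field K] (n d : ℕ) : URing K n d :=
  ∑ α : ExpLE n d, X (Sum.inr α) * ∏ i : Fin n, X (Sum.inl i) ^ (α.1 i)

/-- The monomials `1, xᵢ, c_α, c_α xᵢ`. -/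
def allowedMonomials (K : Type*) [Field K] (n d : ℕ) : Set (URing K n d) :=
  {1} ∪ (Set.range fun i : Fin n => (X (Sum.inl i) : URing K n d))
    ∪ (Set.range fun α : ExpLE n d => (X (Sum.inr α) : URing K n d))
    ∪ (Set.range fun p : ExpLE n d × Fin n =>
        (X (Sum.inr p.1) * X (Sum.inl p.2) : URing K n d))

/-- A uniform determinantal representation of `p_{n,d}` of size `N`. -/
def IsUDR (K : Type*) [Field K] (n d N : ℕ)
    (M : Matrix (Fin N) (Fin N) (URing K n d)) : Prop :=
  (∀ i j, M i j ∈ Submodule.span K (allowedMonomials K n d)) ∧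
    M.det = genPoly K n d

/-- `N*(n,d)`: the minimal size of a uniform determinantal representation. -/
noncomputable def Nstar (K : Type*) [Field K] (n d : ℕ) : ℕ :=
  sInf {N : ℕ | ∃ M : Matrix (Fin N) (Fin N) (URing K n d), IsUDR K n d N M}

/-- Setting all the `c_α` to zero: `M ↦ M₀` entrywise. -/
noncomputable def killC (K : Type*) [Field K] (n d : ℕ) :
    URing K n d →ₐ[K] MvPolynomial (Fin n) K :=
  aeval (Sum.elim X fun _ => 0)

/-- A subspace `V ⊆ K[x₁,…,xₙ]` is connected to 1. -/
def ConnectedToOne (K : Type*) [Field K] (n : ℕ)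
    (V : Submodule K (MvPolynomial (Fin n) K)) : Prop :=
  V ≠ ⊥ ∧ ∀ e : ℕ,
    V ⊓ restrictTotalDegree (Fin n) K (e + 1) ≤
      restrictTotalDegree (Fin n) K 1 * (V ⊓ restrictTotalDegree (Fin n) K e)

/-- The Leibniz rule for a derivation applied to a finite product. -/
theorem Derivation.map_finset_prod {R A ι : Type*} [CommRing R] [CommRing A] [Algebra R A]
    [DecidableEq ι] (D : Derivation R A A) (s : Finset ι) (f : ι → A) :
    D (∏ i ∈ s, f i) = ∑ i ∈ s, (∏ k ∈ s.erase i, f k) * D (f i) := by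
  induction s using Finset.induction_on with
  | empty => simp
  | insert a s ha ih =>
    rw [Finset.prod_insert ha, D.leibniz, ih, Finset.sum_insert ha, Finset.erase_insert ha,
      smul_eq_mul, smul_eq_mul, add_comm, Finset.mul_sum]
    congr 1
    refine Finset.sum_congr rfl fun i hi => ?_
    have hai : a ≠ i := fun h => ha (h ▸ hi)
    rw [Finset.erase_insert_of_ne hai, Finset.prod_insert (fun h => ha (Finset.mem_of_mem_erase h)),
      mul_assoc]

/-- A derivation of a determinant is the sum over the columns of the determinants in which that
column is differentiated. -/
theorem Derivation.map_det {R A m : Type*} [CommRing R] [CommRing A] [Algebra R A]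
    [DecidableEq m] [Fintype m] (D : Derivation R A A) (M : Matrix m m A) :
    D M.det = ∑ j, (M.updateCol j fun i => D (M i j)).det := by
  simp only [Matrix.det_apply, map_sum]
  rw [Finset.sum_comm]
  refine Finset.sum_congr rfl fun σ _ => ?_
  rw [← Finset.smul_sum, Units.smul_def, Units.smul_def, map_zsmul, D.map_finset_prod]
  congr 1
  refine Finset.sum_congr rfl fun j hj => ?_
  rw [← Finset.prod_erase_mul _ _ hj, Matrix.updateCol_self]
  congr 1
  refine Finset.prod_congr rfl fun k hk => ?_
  rw [Matrix.updateCol_ne (Finset.ne_of_mem_erase hk)]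

section

variable (K : Type*) [Field K] {n d : ℕ}

theorem killC_pderiv_genPoly (α : ExpLE n d) :
    killC K n d (pderiv (Sum.inr α) (genPoly K n d)) = monomial α.1 1 := by
  rw [genPoly, map_sum, map_sum, Finset.sum_eq_single α]
  · simp [killC, Derivation.leibniz, monomial_eq, Finsupp.prod_fintype]
  · intro β _ hβ
    have h : (Sum.inr β : Fin n ⊕ ExpLE n d) ≠ Sum.inr α := fun h => hβ (Sum.inr_injective h)
    simp [killC, Derivation.leibniz, pderiv_X_of_ne h]
  · simp

theorem killC_pderiv_mem_restrictTotalDegree (α : ExpLE n d) {p : URing K n d}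
    (hp : p ∈ Submodule.span K (allowedMonomials K n d)) :
    killC K n d (pderiv (Sum.inr α) p) ∈ restrictTotalDegree (Fin n) K 1 := by
  induction hp using Submodule.span_induction with
  | zero => simp
  | add x y _ _ hx hy => simpa using Submodule.add_mem _ hx hy
  | smul a x _ hx => simpa using Submodule.smul_mem _ a hx
  | mem x hx =>
    rw [mem_restrictTotalDegree]
    rcases hx with ((rfl | ⟨i, rfl⟩) | ⟨β, rfl⟩) | ⟨⟨β, i⟩, rfl⟩
    · simp
    · simp
    · rcases eq_or_ne β α with rfl | h
      · simp
      · have h' : (Sum.inr β : Fin n ⊕ ExpLE n d) ≠ Sum.inr α := fun e => h (Sum.inr_injective e)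
        simp [pderiv_X_of_ne h']
    · rcases eq_or_ne β α with rfl | h
      · simp [killC, Derivation.leibniz]
      · have h' : (Sum.inr β : Fin n ⊕ ExpLE n d) ≠ Sum.inr α := fun e => h (Sum.inr_injective e)
        simp [killC, Derivation.leibniz, pderiv_X_of_ne h']

end

/-- Lemma 2.6. If `M = M₀ + M₁` is a uniform determinantal representation of
`p_{n,d}` of size `N+1`, and `V` is the span of the `N × N` subdeterminants of `M₀`
(obtained by deleting one row and one column), then `F₁ · V ⊇ F_d`. -/
theorem udr_subdeterminant_span (K : Type*) [Field K] (n d : ℕ) (N : ℕ)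
    (M : Matrix (Fin (N + 1)) (Fin (N + 1)) (URing K n d))
    (hM : IsUDR K n d (N + 1) M) :
    restrictTotalDegree (Fin n) K d ≤
      restrictTotalDegree (Fin n) K 1 *
        Submodule.span K (Set.range fun ij : Fin (N + 1) × Fin (N + 1) =>
          ((M.map (killC K n d)).submatrix ij.1.succAbove ij.2.succAbove).det) := by
  intro f hf
  have hdeg : f.totalDegree ≤ d := (mem_restrictTotalDegree _ _ _).mp hf
  rw [f.as_sum]
  refine Submodule.sum_mem _ fun β hβ => ?_
  rw [← mul_one (coeff β f), ← C_mul_monomial, C_mul']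
  refine Submodule.smul_mem _ _ ?_
  obtain ⟨α, rfl⟩ : ∃ α : ExpLE n d, α.1 = β := ⟨⟨β, (le_totalDegree hβ).trans hdeg⟩, rfl⟩
  rw [← killC_pderiv_genPoly K α, ← hM.2, Derivation.map_det, map_sum]
  refine Submodule.sum_mem _ fun j _ => ?_
  rw [Matrix.det_succ_column _ j, map_sum]
  refine Submodule.sum_mem _ fun i _ => ?_
  rw [Matrix.updateCol_self, Matrix.submatrix_updateCol_succAbove, mul_assoc, map_mul, map_mul,
    map_pow, map_neg, map_one, AlgHom.map_det]
  have hmem := Submodule.mul_mem_mul (killC_pderiv_mem_restrictTotalDegree K α (hM.1 i j))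
    (Submodule.subset_span (R := K) (Set.mem_range_self (f := fun ij : Fin (N + 1) × Fin (N + 1) =>
      ((M.map (killC K n d)).submatrix ij.1.succAbove ij.2.succAbove).det) (i, j)))
  rcases neg_one_pow_eq_or (MvPolynomial (Fin n) K) (i + j : ℕ) with h | h
  · rw [h, one_mul]
    exact hmem
  · rw [h, neg_one_mul]
    exact Submodule.neg_mem _ hmem
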